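/- arXiv:2508.12654 — 2 statements merged into one kernel-verified Lean document; each statement's English description precedes it below -/
import Mathlib

section
/- Let m ≥ 1 be an integer and Y an infinite type. For partitions π₁ and π₂ of m, W_{π₁}(Y) ⊆ W_{π₂}(Y) if and only if π₂ ≤ π₁ (i.e., π₁ refines π₂). -/
open Multiset

/-- `W π Y` is the set of multisets `a_1•{y_1} + ⋯ + a_k•{y_k}` in `Sym Y m`,
where `(a_1,…,a_k)` are the parts of the partition `π` of `m`. -/
def W {m : ℕ} (π : Nat.Partition m) (Y : Type*) : Set (Sym Y m) :=
  {s | ∃ t : Multiset (ℕ × Y), t.map Prod.fst = π.parts ∧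
        (t.map fun p => Multiset.replicate p.1 p.2).sum = s.1}


/-- `Coarsens π π′` means `π ≥ π′`, i.e. `π′` refines `π`: the parts of `π′` can be
grouped (by a surjection on the index sets of parts) so that each group sums to the
corresponding part of `π`.  Encoded via a multiset `t` of groups of parts. -/
def Coarsens {m : ℕ} (π π' : Nat.Partition m) : Prop :=
  ∃ t : Multiset (Multiset ℕ), t.map Multiset.sum = π.parts ∧ t.sum = π'.parts

theorem sum_map_replicate_eq_replicate_sum {Y : Type*} (g : Multiset ℕ) (y : Y) :
    (g.map fun a => replicate a y).sum = replicate g.sum y := by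
  induction g using Multiset.induction_on with
  | empty => simp
  | cons a g ih => simp [ih, replicate_add]

/-- Splitting each weight of a weighted family of points into a group of smaller weights
does not change the multiset of points. -/
theorem exists_split_of_rel {Y : Type*} {u : Multiset (ℕ × Y)} {t : Multiset (Multiset ℕ)}
    (h : Multiset.Rel (fun p g => p.1 = g.sum) u t) :
    ∃ v : Multiset (ℕ × Y), v.map Prod.fst = t.sum ∧
      (v.map fun p => replicate p.1 p.2).sum = (u.map fun p => replicate p.1 p.2).sum := by
  induction h with
  | zero => exact ⟨0, by simp⟩
  | @cons p g u t hpg _ ih =>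
    obtain ⟨v, hv₁, hv₂⟩ := ih
    refine ⟨g.map (fun a => (a, p.2)) + v, ?_, ?_⟩
    · simp [hv₁, Multiset.map_map]
    · simp [hv₂, Multiset.map_map, hpg, sum_map_replicate_eq_replicate_sum]

/-- The parts of a multiset of natural numbers can be attached to distinct points of an
infinite type. -/
theorem exists_map_fst_eq_nodup_map_snd (Y : Type*) [Infinite Y] (a : Multiset ℕ) :
    ∃ u : Multiset (ℕ × Y), u.map Prod.fst = a ∧ (u.map Prod.snd).Nodup := by
  classical
  induction a using Multiset.induction_on with
  | empty => exact ⟨0, by simp⟩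
  | cons n a ih =>
    obtain ⟨u, hu₁, hu₂⟩ := ih
    obtain ⟨y, hy⟩ := Infinite.exists_notMem_finset (u.map Prod.snd).toFinset
    rw [mem_toFinset] at hy
    refine ⟨(n, y) ::ₘ u, by simp [hu₁], ?_⟩
    rw [map_cons, nodup_cons]
    exact ⟨hy, hu₂⟩

theorem count_sum_map_replicate {Y : Type*} [DecidableEq Y] (v : Multiset (ℕ × Y)) (y : Y) :
    count y (v.map fun p => replicate p.1 p.2).sum =
      ((v.filter fun p => p.2 = y).map Prod.fst).sum := by
  induction v using Multiset.induction_on with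
  | empty => simp
  | cons p v ih =>
    by_cases h : p.2 = y <;> simp [h, ih, count_replicate]

theorem card_sum_map_replicate {Y : Type*} (v : Multiset (ℕ × Y)) :
    card (v.map fun p => replicate p.1 p.2).sum = (v.map Prod.fst).sum := by
  induction v using Multiset.induction_on with
  | empty => simp
  | cons p v ih => simp [ih]

theorem filter_snd_eq_singleton {α Y : Type*} [DecidableEq Y] {u : Multiset (α × Y)}
    (hu : (u.map Prod.snd).Nodup) {p : α × Y} (hp : p ∈ u) :
    (u.filter fun q => q.2 = p.2) = {p} := by
  obtain ⟨u, rfl⟩ := exists_cons_of_mem hp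
  rw [map_cons, nodup_cons] at hu
  rw [filter_cons_of_pos (p := fun q => q.2 = p.2) u rfl, filter_eq_nil.2, cons_zero]
  exact fun q hq h => hu.1 (h ▸ mem_map_of_mem Prod.snd hq)

theorem sum_map_filter_snd_eq {α Y : Type*} [DecidableEq Y] (v : Multiset (α × Y))
    {L : Multiset Y} (hL : L.Nodup) :
    (L.map fun y => v.filter fun q => q.2 = y).sum = v.filter fun q => q.2 ∈ L := by
  induction L using Multiset.induction_on with
  | empty => simp
  | cons y L ih =>
    rw [nodup_cons] at hL
    have hdisj : (v.filter fun q => q.2 = y ∧ q.2 ∈ L) = 0 :=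
      filter_eq_nil.2 fun q _ h => hL.1 (h.1 ▸ h.2)
    rw [map_cons, sum_cons, ih hL.2, filter_add_filter, hdisj, add_zero]
    simp only [mem_cons]

theorem mem_sum_map_replicate {Y : Type*} {v : Multiset (ℕ × Y)} {y : Y} :
    y ∈ (v.map fun p => replicate p.1 p.2).sum ↔ ∃ p ∈ v, p.1 ≠ 0 ∧ p.2 = y :=
  mem_bind.trans (by simp only [mem_replicate, eq_comm])

/-- For an infinite type `Y`, `W_{π₁}(Y) ⊆ W_{π₂}(Y)` if and only if `π₂ ≤ π₁`
(i.e. `π₁` is a coarsening of `π₂`, `π₁` being refined by `π₂`). -/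
theorem W_subset_W_iff (m : ℕ) (hm : 1 ≤ m) (Y : Type*) [Infinite Y]
    (π₁ π₂ : Nat.Partition m) :
    W π₁ Y ⊆ W π₂ Y ↔ Coarsens π₁ π₂ := by
  let _ : DecidableEq Y := Classical.decEq Y
  constructor
  · intro h
    obtain ⟨u, hu₁, hu₂⟩ := exists_map_fst_eq_nodup_map_snd Y π₁.parts
    obtain ⟨v, hv₁, hv₂⟩ := h (show (⟨(u.map fun p => replicate p.1 p.2).sum, by
      rw [card_sum_map_replicate, hu₁, π₁.parts_sum]⟩ : Sym Y m) ∈ W π₁ Y from ⟨u, hu₁, rfl⟩)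
    change _ = (u.map fun p => replicate p.1 p.2).sum at hv₂
    refine ⟨u.map fun p => (v.filter fun q => q.2 = p.2).map Prod.fst, ?_, ?_⟩
    · rw [← hu₁, Multiset.map_map]
      refine map_congr rfl fun p hp => ?_
      rw [Function.comp_apply, ← count_sum_map_replicate, hv₂, count_sum_map_replicate,
        filter_snd_eq_singleton hu₂ hp, map_singleton, sum_singleton]
    · have hmem : ∀ q ∈ v, q.2 ∈ u.map Prod.snd := by
        intro q hq
        have hpos : 0 < q.1 := π₂.parts_pos (hv₁ ▸ mem_map_of_mem Prod.fst hq)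
        have hq' : q.2 ∈ (u.map fun p => replicate p.1 p.2).sum :=
          hv₂ ▸ mem_sum_map_replicate.2 ⟨q, hq, hpos.ne', rfl⟩
        obtain ⟨p, hp, -, hpq⟩ := mem_sum_map_replicate.1 hq'
        exact hpq ▸ mem_map_of_mem Prod.snd hp
      have hsum := sum_map_filter_snd_eq v hu₂
      rw [filter_eq_self.2 hmem, Multiset.map_map] at hsum
      rw [← hv₁]
      conv_rhs => rw [← hsum, ← coe_mapAddMonoidHom, map_multiset_sum, Multiset.map_map]
      rfl
  · rintro ⟨t, ht₁, ht₂⟩ s ⟨u, hu₁, hu₂⟩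
    have hrel : Multiset.Rel (fun (p : ℕ × Y) (g : Multiset ℕ) => p.1 = g.sum) u t := by
      rw [← rel_map, rel_eq, hu₁, ht₁]
    obtain ⟨v, hv₁, hv₂⟩ := exists_split_of_rel hrel
    exact ⟨v, hv₁.trans ht₂, hv₂.trans hu₂⟩
end

section
/- Let m ≥ 1 be an integer and Y any type. For every partition π of m, W_π(Y) = ⋃_{π′ ≥ π} W°_{π′}(Y), where π′ ranges over all coarsenings of π (partitions π′ of m with π′ ≥ π); moreover the sets W°_{π′}(Y), as π′ ranges over all partitions of m, are pairwise disjoint, so this union is a disjoint union. -/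
open Multiset

/-- `Wo π Y = W π Y \ ⋃_{π′ > π} W π′ Y`, the open stratum. -/
def Wo {m : ℕ} (π : Nat.Partition m) (Y : Type*) : Set (Sym Y m) :=
  W π Y \ ⋃ (π' : Nat.Partition m) (_ : Coarsens π' π ∧ π' ≠ π), W π' Y


/-- The partition of `m` formed by the multiplicities of the distinct elements of `s`. -/
def multiplicityPartition {m : ℕ} {Y : Type*} [DecidableEq Y] (s : Sym Y m) :
    Nat.Partition m where
  parts := s.1.toFinset.val.map fun y => s.1.count y
  parts_pos := by
    intro i hi
    obtain ⟨y, hy, rfl⟩ := Multiset.mem_map.1 hi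
    exact Multiset.count_pos.2 (Multiset.mem_toFinset.1 hy)
  parts_sum := (Multiset.toFinset_sum_count_eq s.1).trans s.2

theorem mem_W_multiplicityPartition {m : ℕ} {Y : Type*} [DecidableEq Y] (s : Sym Y m) :
    s ∈ W (multiplicityPartition s) Y := by
  refine ⟨s.1.toFinset.val.map fun y => (s.1.count y, y), ?_, ?_⟩
  · simp [multiplicityPartition, Multiset.map_map]
  · rw [Multiset.map_map]
    refine Eq.trans ?_ (Multiset.toFinset_sum_count_nsmul_eq s.1)
    simp only [Function.comp_def, ← Multiset.nsmul_singleton]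
    rfl

theorem sum_fst_filter_snd_eq_count {Y : Type*} [DecidableEq Y] (u : Multiset (ℕ × Y)) (y : Y) :
    ((u.filter fun p => p.2 = y).map Prod.fst).sum =
      (u.map fun p => Multiset.replicate p.1 p.2).sum.count y := by
  induction u using Multiset.induction with
  | empty => simp
  | cons p u ih =>
    by_cases h : p.2 = y
    · simp [h, ih]
    · simp [h, ih, Multiset.count_replicate]

theorem sum_map_fst_filter_snd {α Y : Type*} [DecidableEq Y] (S : Finset Y)
    (u : Multiset (α × Y)) (hu : ∀ p ∈ u, p.2 ∈ S) :
    ∑ y ∈ S, (u.filter fun p => p.2 = y).map Prod.fst = u.map Prod.fst := by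
  induction u using Multiset.induction with
  | empty => simp
  | cons p u ih =>
    have hp : p.2 ∈ S := hu p (Multiset.mem_cons_self p u)
    have hcons : ∀ y, ((p ::ₘ u).filter fun p => p.2 = y).map Prod.fst =
        (if p.2 = y then {p.1} else 0) + (u.filter fun p => p.2 = y).map Prod.fst := by
      intro y
      by_cases h : p.2 = y <;> simp [h]
    simp only [hcons]
    rw [Finset.sum_add_distrib, ih fun q hq => hu q (Multiset.mem_cons_of_mem hq),
      Finset.sum_ite_eq, if_pos hp, Multiset.map_cons, Multiset.singleton_add]

theorem multiplicityPartition_coarsens {m : ℕ} {Y : Type*} [DecidableEq Y] {s : Sym Y m}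
    {π : Nat.Partition m} (hs : s ∈ W π Y) : Coarsens (multiplicityPartition s) π := by
  obtain ⟨u, hu, hsum⟩ := hs
  refine ⟨s.1.toFinset.val.map fun y => (u.filter fun p => p.2 = y).map Prod.fst, ?_, ?_⟩
  · simp only [Multiset.map_map, Function.comp_def, sum_fst_filter_snd_eq_count, hsum]
    rfl
  · rw [← hu]
    refine sum_map_fst_filter_snd s.1.toFinset u fun p hp => ?_
    have hpos : 0 < p.1 := π.parts_pos (hu ▸ Multiset.mem_map_of_mem Prod.fst hp)
    rw [Multiset.mem_toFinset, ← hsum]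
    exact Multiset.mem_bind.2 ⟨p, hp, Multiset.mem_replicate.2 ⟨hpos.ne', rfl⟩⟩

theorem exists_refined_labelling {Y : Type*} (t : Multiset (Multiset ℕ)) (u : Multiset (ℕ × Y))
    (h : u.map Prod.fst = t.map Multiset.sum) :
    ∃ v : Multiset (ℕ × Y), v.map Prod.fst = t.sum ∧
      (v.map fun p => Multiset.replicate p.1 p.2).sum =
        (u.map fun p => Multiset.replicate p.1 p.2).sum := by
  classical
  induction t using Multiset.induction generalizing u with
  | empty => exact ⟨0, by simp_all⟩
  | cons g t ih =>
    rw [Multiset.map_cons, ← Multiset.map_eq_cons] at h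
    obtain ⟨p, hp, hpg, hrest⟩ := h
    obtain ⟨v, hv, hvsum⟩ := ih _ hrest
    refine ⟨g.map (fun a => (a, p.2)) + v, ?_, ?_⟩
    · simp [hv, Multiset.map_map]
    · rw [← Multiset.cons_erase hp, Multiset.map_add, Multiset.sum_add, hvsum,
        Multiset.map_cons, Multiset.sum_cons, hpg, Multiset.map_map]
      congr 1
      simp only [Function.comp_def, ← Multiset.nsmul_singleton]
      exact (Multiset.sum_smul ..).symm

theorem W_subset_of_coarsens {m : ℕ} {π π' : Nat.Partition m} (h : Coarsens π' π) (Y : Type*) :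
    W π' Y ⊆ W π Y := by
  rintro s ⟨u, hu, hsum⟩
  obtain ⟨t, ht, htsum⟩ := h
  obtain ⟨v, hv, hvsum⟩ := exists_refined_labelling t u (hu.trans ht.symm)
  exact ⟨v, hv.trans htsum, hvsum.trans hsum⟩

theorem card_le_card_sum_of_ne_zero {α : Type*} (t : Multiset (Multiset α)) (h : ∀ g ∈ t, g ≠ 0) :
    t.card ≤ t.sum.card := by
  induction t using Multiset.induction with
  | empty => simp
  | cons g t ih =>
    have hg := Multiset.card_pos.2 (h g (Multiset.mem_cons_self g t))
    have ht := ih fun g' hg' => h g' (Multiset.mem_cons_of_mem hg')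
    simp only [Multiset.card_cons, Multiset.sum_cons, Multiset.card_add]
    lia

theorem map_sum_eq_sum_of_card_le (t : Multiset (Multiset ℕ)) (h : ∀ g ∈ t, g ≠ 0)
    (hcard : t.sum.card ≤ t.card) : t.map Multiset.sum = t.sum := by
  induction t using Multiset.induction with
  | empty => simp
  | cons g t ih =>
    have hg := Multiset.card_pos.2 (h g (Multiset.mem_cons_self g t))
    have h' : ∀ g' ∈ t, g' ≠ 0 := fun g' hg' => h g' (Multiset.mem_cons_of_mem hg')
    have ht := card_le_card_sum_of_ne_zero t h'
    simp only [Multiset.card_cons, Multiset.sum_cons, Multiset.card_add] at hcard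
    obtain ⟨a, rfl⟩ := Multiset.card_eq_one.1 (show g.card = 1 by lia)
    simp [ih h' (by lia)]

namespace Coarsens

variable {m : ℕ} {π π' : Nat.Partition m}

theorem ne_zero_of_map_sum_eq_parts {t : Multiset (Multiset ℕ)}
    (ht : t.map Multiset.sum = π.parts) : ∀ g ∈ t, g ≠ 0 := by
  rintro g hg rfl
  exact (π.parts_pos (ht ▸ Multiset.mem_map_of_mem Multiset.sum hg)).ne' Multiset.sum_zero

theorem card_parts_le (h : Coarsens π π') : π.parts.card ≤ π'.parts.card := by
  obtain ⟨t, ht, htsum⟩ := h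
  rw [← htsum, ← ht, Multiset.card_map]
  exact card_le_card_sum_of_ne_zero t (ne_zero_of_map_sum_eq_parts ht)

theorem antisymm (h : Coarsens π π') (h' : Coarsens π' π) : π = π' := by
  have hcard := h'.card_parts_le
  obtain ⟨t, ht, htsum⟩ := h
  rw [← htsum, ← ht, Multiset.card_map] at hcard
  ext1
  rw [← ht, ← htsum, map_sum_eq_sum_of_card_le t (ne_zero_of_map_sum_eq_parts ht) hcard]

end Coarsens

theorem mem_Wo_iff {m : ℕ} {Y : Type*} [DecidableEq Y] {s : Sym Y m} {π : Nat.Partition m} :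
    s ∈ Wo π Y ↔ multiplicityPartition s = π := by
  simp only [Wo, Set.mem_sdiff, Set.mem_iUnion, not_exists]
  constructor
  · rintro ⟨hs, hnot⟩
    by_contra hne
    exact hnot _ ⟨multiplicityPartition_coarsens hs, hne⟩ (mem_W_multiplicityPartition s)
  · rintro rfl
    refine ⟨mem_W_multiplicityPartition s, fun π' h hs => ?_⟩
    exact h.2 (h.1.antisymm (multiplicityPartition_coarsens hs))

/-- `W_π(Y)` is the union of the open strata `W°_{π′}(Y)` over all coarsenings
`π′ ≥ π`, and the open strata over all partitions are pairwise disjoint, so this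
union is a disjoint union. -/
theorem W_eq_iUnion_Wo_and_pairwise_disjoint (m : ℕ) (hm : 1 ≤ m) (Y : Type*)
    (π : Nat.Partition m) :
    (W π Y = ⋃ (π' : Nat.Partition m) (_ : Coarsens π' π), Wo π' Y) ∧
    (∀ π₁ π₂ : Nat.Partition m, π₁ ≠ π₂ → Disjoint (Wo π₁ Y) (Wo π₂ Y)) := by
  classical
  refine ⟨Set.Subset.antisymm (fun s hs => ?_) ?_, fun π₁ π₂ hne => ?_⟩
  · exact Set.mem_iUnion₂.2 ⟨_, multiplicityPartition_coarsens hs, mem_Wo_iff.2 rfl⟩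
  · exact Set.iUnion₂_subset fun π' h =>
      Set.sdiff_subset.trans (W_subset_of_coarsens h Y)
  · refine Set.disjoint_left.2 fun s h₁ h₂ => hne ?_
    exact (mem_Wo_iff.1 h₁).symm.trans (mem_Wo_iff.1 h₂)
end
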